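/- Let K be a symmetric convex set in ℝⁿ and let γₙ denote the standard Gaussian measure on ℝⁿ. Then the function t ↦ γₙ(Δ(t,1,…,1)K) is nondecreasing for t > 0, where Δ(t,1,…,1) is the diagonal matrix with diagonal entries t,1,…,1. -/

import Mathlib

open MeasureTheory

section

open scoped ENNReal Pointwise

theorem ENNReal.rpow_mul_rpow_le_add {a b : ℝ} (ha : 0 < a) (hb : 0 < b) (hab : a + b = 1)
    (x y : ℝ≥0∞) : x ^ a * y ^ b ≤ ENNReal.ofReal a * x + ENNReal.ofReal b * y := by
  rcases eq_or_ne x ∞ with rfl | hx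
  · simp [ENNReal.mul_top, ha]
  rcases eq_or_ne y ∞ with rfl | hy
  · simp [ENNReal.mul_top, hb]
  lift x to NNReal using hx
  lift y to NNReal using hy
  have h := NNReal.geom_mean_le_arith_mean2_weighted ⟨a, ha.le⟩ ⟨b, hb.le⟩ x y
    (NNReal.eq hab)
  rw [← ENNReal.coe_rpow_of_nonneg _ ha.le, ← ENNReal.coe_rpow_of_nonneg _ hb.le,
    ENNReal.ofReal_eq_coe_nnreal ha.le, ENNReal.ofReal_eq_coe_nnreal hb.le]
  exact_mod_cast h

/-- The one-dimensional Brunn–Minkowski inequality for compact sets. -/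
theorem volume_add_le_volume_add_of_isCompact {A B : Set ℝ} (hA : IsCompact A) (hB : IsCompact B)
    (hA' : A.Nonempty) (hB' : B.Nonempty) : volume A + volume B ≤ volume (A + B) := by
  obtain ⟨p, hpA, hp⟩ := hA.exists_isGreatest hA'
  obtain ⟨q, hqB, hq⟩ := hB.exists_isLeast hB'
  have hsub : (q +ᵥ A) ∪ (p +ᵥ B) ⊆ A + B := by
    rintro _ (⟨x, hx, rfl⟩ | ⟨x, hx, rfl⟩)
    · exact ⟨x, hx, q, hqB, add_comm _ _⟩
    · exact ⟨p, hpA, x, hx, rfl⟩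
  have hdisj : AEDisjoint volume (q +ᵥ A) (p +ᵥ B) := by
    refine measure_mono_null (t := {p + q}) ?_ (by simp)
    rintro _ ⟨⟨x, hx, rfl⟩, ⟨y, hy, hxy⟩⟩
    have h₁ := hp hx
    have h₂ := hq hy
    simp only [vadd_eq_add, Set.mem_singleton_iff] at hxy ⊢
    linarith
  calc volume A + volume B = volume ((q +ᵥ A) ∪ (p +ᵥ B)) := by
        rw [measure_union₀ (hB.measurableSet.const_vadd p).nullMeasurableSet hdisj,
          measure_vadd, measure_vadd]
    _ ≤ _ := measure_mono hsub

/-- The one-dimensional Brunn–Minkowski inequality. -/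
theorem volume_add_le_volume_add {A B : Set ℝ} (hA : MeasurableSet A) (hB : MeasurableSet B)
    (hA' : A.Nonempty) (hB' : B.Nonempty) : volume A + volume B ≤ volume (A + B) := by
  obtain ⟨p, hp⟩ := hA'
  obtain ⟨q, hq⟩ := hB'
  rw [hA.measure_eq_iSup_isCompact, hB.measure_eq_iSup_isCompact]
  simp only [iSup_and']
  refine ENNReal.biSup_add_biSup_le' ⟨∅, by simp⟩ ⟨∅, by simp⟩ fun S hS T hT => ?_
  calc volume S + volume T ≤ volume (insert p S) + volume (insert q T) := by
        gcongr <;> exact Set.subset_insert _ _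
    _ ≤ volume (insert p S + insert q T) := volume_add_le_volume_add_of_isCompact
        (hS.2.insert p) (hT.2.insert q) (Set.insert_nonempty _ _) (Set.insert_nonempty _ _)
    _ ≤ volume (A + B) := measure_mono <|
        Set.add_subset_add (Set.insert_subset hp hS.1) (Set.insert_subset hq hT.1)

theorem lintegral_add_lintegral_le_of_forall_le {a b : ℝ} (ha : 0 < a) (hb : 0 < b)
    (hab : a + b = 1) {f g h : ℝ → ℝ≥0∞} (hf : Measurable f) (hg : Measurable g)
    (hh : Measurable h) (hf1 : ⨆ x, f x = 1) (hg1 : ⨆ x, g x = 1)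
    (hfgh : ∀ x y, f x ^ a * g y ^ b ≤ h (a * x + b * y)) :
    ENNReal.ofReal a * (∫⁻ x, f x) + ENNReal.ofReal b * (∫⁻ x, g x) ≤ ∫⁻ x, h x := by
  have layer : ∀ u : ℝ → ℝ≥0∞, Measurable u → (∀ x, u x ≤ 1) →
      ∫⁻ x, u x = ∫⁻ t in Set.Ioi (0 : ℝ), volume {x | ENNReal.ofReal t < u x} := by
    intro u hu hu1
    have hfin : ∀ x, u x ≠ ∞ := fun x => ((hu1 x).trans_lt ENNReal.one_lt_top).ne
    calc ∫⁻ x, u x = ∫⁻ x, ENNReal.ofReal (u x).toReal := by simp [hfin]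
      _ = _ := by
        rw [lintegral_eq_lintegral_meas_lt _ (Filter.Eventually.of_forall fun _ =>
          ENNReal.toReal_nonneg) hu.ennreal_toReal.aemeasurable]
        refine setLIntegral_congr_fun measurableSet_Ioi fun t ht => ?_
        simp only [ENNReal.ofReal_lt_iff_lt_toReal (le_of_lt ht) (hfin _)]
  have hfle : ∀ x, f x ≤ 1 := fun x => hf1 ▸ le_iSup f x
  have hgle : ∀ x, g x ≤ 1 := fun x => hg1 ▸ le_iSup g x
  have hmeas : ∀ u : ℝ → ℝ≥0∞, Measurable fun t : ℝ => volume {x | ENNReal.ofReal t < u x} := by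
    intro u
    refine Antitone.measurable fun s t hst => measure_mono fun x hx => ?_
    exact (ENNReal.ofReal_le_ofReal hst).trans_lt hx
  calc _ = ∫⁻ t in Set.Ioi (0 : ℝ), (ENNReal.ofReal a * volume {x | ENNReal.ofReal t < f x} +
          ENNReal.ofReal b * volume {x | ENNReal.ofReal t < g x}) := by
        rw [lintegral_add_left ((hmeas f).const_mul _), lintegral_const_mul _ (hmeas f),
          lintegral_const_mul _ (hmeas g), layer f hf hfle, layer g hg hgle]
    _ ≤ ∫⁻ t in Set.Ioi (0 : ℝ), volume {x | ENNReal.ofReal t < min (h x) 1} := by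
        refine setLIntegral_mono' measurableSet_Ioi fun t ht => ?_
        rcases le_or_gt 1 (ENNReal.ofReal t) with h1 | h1
        · simp [((hfle _).trans h1).not_gt, ((hgle _).trans h1).not_gt]
        obtain ⟨p, hp⟩ := lt_iSup_iff.1 (hf1.symm ▸ h1)
        obtain ⟨q, hq⟩ := lt_iSup_iff.1 (hg1.symm ▸ h1)
        set A := {x | ENNReal.ofReal t < f x}
        set B := {x | ENNReal.ofReal t < g x}
        have hA : MeasurableSet A := measurableSet_lt measurable_const hf
        have hB : MeasurableSet B := measurableSet_lt measurable_const hg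
        have hsmul : ∀ {c : ℝ}, 0 < c → ∀ s : Set ℝ,
            ENNReal.ofReal c * volume s = volume (c • s) := by
          intro c hc s
          simp [Measure.addHaar_smul, abs_of_pos hc]
        rw [hsmul ha, hsmul hb]
        refine (volume_add_le_volume_add (hA.const_smul₀ a) (hB.const_smul₀ b)
          (Set.Nonempty.smul_set ⟨p, hp⟩) (Set.Nonempty.smul_set ⟨q, hq⟩)).trans
          (measure_mono ?_)
        rintro _ ⟨_, ⟨x, hx, rfl⟩, _, ⟨y, hy, rfl⟩, rfl⟩
        refine lt_min (lt_of_lt_of_le ?_ (hfgh x y)) h1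
        calc ENNReal.ofReal t = ENNReal.ofReal t ^ a * ENNReal.ofReal t ^ b := by
              rw [← ENNReal.rpow_add_of_nonneg _ _ ha.le hb.le, hab, ENNReal.rpow_one]
          _ < _ := ENNReal.mul_lt_mul (ENNReal.rpow_lt_rpow hx ha) (ENNReal.rpow_lt_rpow hy hb)
    _ = ∫⁻ x, min (h x) 1 := (layer _ (hh.min measurable_const) fun _ => min_le_right _ _).symm
    _ ≤ _ := lintegral_mono fun _ => min_le_left _ _

theorem prekopa_leindler_real_of_bounded {a b : ℝ} (ha : 0 < a) (hb : 0 < b) (hab : a + b = 1)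
    {f g h : ℝ → ℝ≥0∞} (hf : Measurable f) (hg : Measurable g) (hh : Measurable h)
    (hf_top : ⨆ x, f x ≠ ∞) (hg_top : ⨆ x, g x ≠ ∞)
    (hfgh : ∀ x y, f x ^ a * g y ^ b ≤ h (a * x + b * y)) :
    (∫⁻ x, f x) ^ a * (∫⁻ x, g x) ^ b ≤ ∫⁻ x, h x := by
  set F := ⨆ x, f x with hF
  set G := ⨆ x, g x with hG
  rcases eq_or_ne F 0 with hF0 | hF0
  · have : ∀ x, f x = 0 := by simpa using hF.symm.trans hF0
    simp [this, ha]
  rcases eq_or_ne G 0 with hG0 | hG0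
  · have : ∀ x, g x = 0 := by simpa using hG.symm.trans hG0
    simp [this, hb]
  have hFi : F⁻¹ ≠ ∞ := by simpa
  have hGi : G⁻¹ ≠ ∞ := by simpa
  set c := F⁻¹ ^ a * G⁻¹ ^ b
  have key := lintegral_add_lintegral_le_of_forall_le ha hb hab (hf.const_mul F⁻¹)
    (hg.const_mul G⁻¹) (hh.const_mul c)
    (by rw [← ENNReal.mul_iSup, ENNReal.inv_mul_cancel hF0 hf_top])
    (by rw [← ENNReal.mul_iSup, ENNReal.inv_mul_cancel hG0 hg_top])
    (fun x y => by
      rw [ENNReal.mul_rpow_of_nonneg _ _ ha.le, ENNReal.mul_rpow_of_nonneg _ _ hb.le,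
        mul_mul_mul_comm]
      gcongr
      exact hfgh x y)
  rw [lintegral_const_mul _ hf, lintegral_const_mul _ hg, lintegral_const_mul _ hh] at key
  have key' := (ENNReal.rpow_mul_rpow_le_add ha hb hab _ _).trans key
  rw [ENNReal.mul_rpow_of_nonneg _ _ ha.le, ENNReal.mul_rpow_of_nonneg _ _ hb.le,
    mul_mul_mul_comm] at key'
  refine (ENNReal.mul_le_mul_iff_right ?_ ?_).1 key'
  · simp [hF0, hG0, hf_top, hg_top, ha, hb]
  · exact ENNReal.mul_ne_top (ENNReal.rpow_ne_top_of_nonneg ha.le hFi)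
      (ENNReal.rpow_ne_top_of_nonneg hb.le hGi)

/-- The one-dimensional Prékopa–Leindler inequality. -/
theorem prekopa_leindler_real {a b : ℝ} (ha : 0 < a) (hb : 0 < b) (hab : a + b = 1)
    {f g h : ℝ → ℝ≥0∞} (hf : Measurable f) (hg : Measurable g) (hh : Measurable h)
    (hfgh : ∀ x y, f x ^ a * g y ^ b ≤ h (a * x + b * y)) :
    (∫⁻ x, f x) ^ a * (∫⁻ x, g x) ^ b ≤ ∫⁻ x, h x := by
  have trunc : ∀ {c : ℝ}, 0 < c → ∀ u : ℝ → ℝ≥0∞, Measurable u →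
      (∫⁻ x, u x) ^ c = ⨆ N : ℕ, (∫⁻ x, min (u x) N) ^ c := by
    intro c hc u hu
    have hsup : ∀ x, u x = ⨆ N : ℕ, min (u x) N := fun x => by
      rw [← inf_iSup_eq, ENNReal.iSup_natCast, inf_top_eq]
    have hmono : Monotone fun (N : ℕ) x => min (u x) (N : ℝ≥0∞) := fun M N hMN x =>
      min_le_min_left _ (Nat.cast_le.2 hMN)
    conv_lhs => rw [lintegral_congr hsup,
      lintegral_iSup (fun N => hu.min measurable_const) hmono]
    exact (ENNReal.orderIsoRpow c hc).map_iSup _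
  rw [trunc ha f hf, trunc hb g hg]
  simp only [ENNReal.iSup_mul, ENNReal.mul_iSup, iSup_le_iff]
  intro N M
  refine prekopa_leindler_real_of_bounded ha hb hab (hf.min measurable_const)
    (hg.min measurable_const) hh ?_ ?_ fun x y => le_trans ?_ (hfgh x y)
  · exact ((iSup_le fun _ => min_le_right _ _).trans_lt (ENNReal.natCast_lt_top _)).ne
  · exact ((iSup_le fun _ => min_le_right _ _).trans_lt (ENNReal.natCast_lt_top _)).ne
  · gcongr <;> exact min_le_left _ _

theorem lintegral_fin_succ {n : ℕ} {f : (Fin (n + 1) → ℝ) → ℝ≥0∞} (hf : Measurable f) :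
    ∫⁻ x, f x = ∫⁻ t : ℝ, ∫⁻ y : Fin n → ℝ, f (Fin.cons t y) := by
  have e := (volume_preserving_piFinSuccAbove (fun _ : Fin (n + 1) => ℝ) 0).symm
  rw [← e.lintegral_comp hf, Measure.volume_eq_prod,
    lintegral_prod (fun p => f ((MeasurableEquiv.piFinSuccAbove (fun _ => ℝ) 0).symm p))
      (hf.comp e.measurable).aemeasurable]
  simp [MeasurableEquiv.piFinSuccAbove, Fin.insertNthEquiv]

theorem measurable_fin_cons {n : ℕ} :
    Measurable fun p : ℝ × (Fin n → ℝ) => (Fin.cons p.1 p.2 : Fin (n + 1) → ℝ) := by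
  refine measurable_pi_iff.2 fun i => ?_
  refine Fin.cases ?_ (fun j => ?_) i
  · simpa using measurable_fst
  · simpa using measurable_pi_iff.1 measurable_snd j

/-- The Prékopa–Leindler inequality. -/
theorem prekopa_leindler {a b : ℝ} (ha : 0 < a) (hb : 0 < b) (hab : a + b = 1) {n : ℕ}
    {f g h : (Fin n → ℝ) → ℝ≥0∞} (hf : Measurable f) (hg : Measurable g) (hh : Measurable h)
    (hfgh : ∀ x y, f x ^ a * g y ^ b ≤ h (a • x + b • y)) :
    (∫⁻ x, f x) ^ a * (∫⁻ x, g x) ^ b ≤ ∫⁻ x, h x := by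
  induction n with
  | zero =>
    have hd : (volume : Measure (Fin 0 → ℝ)) = Measure.dirac default := by
      rw [volume_pi, Measure.pi_of_empty _ default]
    simp only [hd, lintegral_dirac]
    convert hfgh default default
  | succ n ih =>
    have hm : ∀ {u : (Fin (n + 1) → ℝ) → ℝ≥0∞}, Measurable u →
        Measurable fun p : ℝ × (Fin n → ℝ) => u (Fin.cons p.1 p.2) :=
      fun hu => hu.comp measurable_fin_cons
    rw [lintegral_fin_succ hf, lintegral_fin_succ hg, lintegral_fin_succ hh]
    refine prekopa_leindler_real ha hb hab (hm hf).lintegral_prod_right'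
      (hm hg).lintegral_prod_right' (hm hh).lintegral_prod_right' fun s t => ?_
    refine ih ((hm hf).comp measurable_prodMk_left) ((hm hg).comp measurable_prodMk_left)
      ((hm hh).comp measurable_prodMk_left) fun x y => ?_
    convert hfgh (Fin.cons s x) (Fin.cons t y) using 2
    ext i
    refine Fin.cases ?_ (fun j => ?_) i <;> simp

/-- Multiplication of the first coordinate by `t`. -/
abbrev dilateFirst (n : ℕ) (t : ℝ) (x : Fin n → ℝ) : Fin n → ℝ :=
  fun i => if (i : ℕ) = 0 then t * x i else x i

theorem isLinearMap_dilateFirst (n : ℕ) (t : ℝ) : IsLinearMap ℝ (dilateFirst n t) where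
  map_add x y := by
    ext i
    by_cases h : (i : ℕ) = 0 <;> simp [dilateFirst, h, mul_add]
  map_smul c x := by
    ext i
    by_cases h : (i : ℕ) = 0 <;> simp [dilateFirst, h, mul_left_comm]

theorem continuous_dilateFirst (n : ℕ) (t : ℝ) : Continuous (dilateFirst n t) :=
  (isLinearMap_dilateFirst n t).mk'.continuous_of_finiteDimensional

theorem dilateFirst_inv_dilateFirst (n : ℕ) {t : ℝ} (ht : t ≠ 0) (x : Fin n → ℝ) :
    dilateFirst n t⁻¹ (dilateFirst n t x) = x := by
  ext i
  by_cases h : (i : ℕ) = 0 <;> simp [dilateFirst, h, ht]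

theorem image_dilateFirst (n : ℕ) {t : ℝ} (ht : t ≠ 0) (K : Set (Fin n → ℝ)) :
    dilateFirst n t '' K = dilateFirst n t⁻¹ ⁻¹' K :=
  congrFun (Set.image_eq_preimage_of_inverse (dilateFirst_inv_dilateFirst n ht)
    fun x => by simpa using dilateFirst_inv_dilateFirst n (inv_ne_zero ht) x) K

theorem dilateFirst_cons {n : ℕ} (t x : ℝ) (y : Fin n → ℝ) :
    dilateFirst (n + 1) t (Fin.cons x y) = Fin.cons (t * x) y := by
  ext i
  refine Fin.cases ?_ (fun j => ?_) i <;> simp [dilateFirst]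

/-- The unnormalized Gaussian density. -/
noncomputable abbrev gaussianWeight {n : ℕ} (x : Fin n → ℝ) : ℝ≥0∞ :=
  ENNReal.ofReal (Real.exp (-(∑ i, x i ^ 2) / 2))

theorem measurable_gaussianWeight {n : ℕ} : Measurable (gaussianWeight (n := n)) := by
  unfold gaussianWeight
  fun_prop

theorem gaussianWeight_logConcave {a b : ℝ} (ha : 0 < a) (hb : 0 < b) (hab : a + b = 1) {n : ℕ}
    (x y : Fin n → ℝ) :
    gaussianWeight x ^ a * gaussianWeight y ^ b ≤ gaussianWeight (a • x + b • y) := by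
  unfold gaussianWeight
  rw [ENNReal.ofReal_rpow_of_pos (Real.exp_pos _), ENNReal.ofReal_rpow_of_pos (Real.exp_pos _),
    ← ENNReal.ofReal_mul (by positivity), ← Real.exp_mul, ← Real.exp_mul, ← Real.exp_add]
  refine ENNReal.ofReal_le_ofReal (Real.exp_le_exp.2 ?_)
  have h : ∑ i, (a • x + b • y) i ^ 2 ≤ a * ∑ i, x i ^ 2 + b * ∑ i, y i ^ 2 := by
    rw [Finset.mul_sum, Finset.mul_sum, ← Finset.sum_add_distrib]
    refine Finset.sum_le_sum fun i _ => ?_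
    simpa using (even_two.convexOn_pow (𝕜 := ℝ)).2 (Set.mem_univ (x i)) (Set.mem_univ (y i))
      ha.le hb.le hab
  linarith

/-- The unnormalized Gaussian measure of the slice of `K` at first coordinate `x`. -/
noncomputable abbrev gaussianSlice {n : ℕ} (K : Set (Fin (n + 1) → ℝ)) (x : ℝ) : ℝ≥0∞ :=
  ∫⁻ y : Fin n → ℝ, K.indicator 1 (Fin.cons x y : Fin (n + 1) → ℝ) * gaussianWeight y

theorem gaussianSlice_le_mul {n : ℕ} {K : Set (Fin (n + 1) → ℝ)} (hK : Convex ℝ K)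
    (hKsymm : K = -K) (hKm : MeasurableSet K) {r : ℝ} (hr : 0 < r) (hr1 : r < 1) (x : ℝ) :
    gaussianSlice K x ≤ gaussianSlice K (r * x) := by
  have hneg : gaussianSlice K (-x) = gaussianSlice K x := by
    unfold gaussianSlice
    rw [← lintegral_neg_eq_self]
    refine lintegral_congr fun y => ?_
    have hcons : (Fin.cons (-x) (-y) : Fin (n + 1) → ℝ) = -Fin.cons x y := by
      ext i
      refine Fin.cases ?_ (fun j => ?_) i <;> simp
    have hmem : (-Fin.cons x y : Fin (n + 1) → ℝ) ∈ K ↔ (Fin.cons x y : Fin (n + 1) → ℝ) ∈ K := by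
      conv_rhs => rw [hKsymm, Set.mem_neg]
    classical
    simp [hcons, Set.indicator_apply, hmem, gaussianWeight]
  have hm : ∀ u : ℝ, Measurable fun y : Fin n → ℝ =>
      K.indicator 1 (Fin.cons u y : Fin (n + 1) → ℝ) * gaussianWeight y := fun u =>
    (((measurable_one.indicator hKm).comp measurable_fin_cons).comp measurable_prodMk_left).mul
      measurable_gaussianWeight
  have ha : 0 < (1 + r) / 2 := by linarith
  have hb : 0 < (1 - r) / 2 := by linarith
  have hab : (1 + r) / 2 + (1 - r) / 2 = 1 := by ring
  calc gaussianSlice K x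
      = gaussianSlice K x ^ ((1 + r) / 2) * gaussianSlice K (-x) ^ ((1 - r) / 2) := by
        rw [hneg, ← ENNReal.rpow_add_of_nonneg _ _ ha.le hb.le, hab, ENNReal.rpow_one]
    _ ≤ gaussianSlice K (r * x) := by
        refine prekopa_leindler ha hb hab (hm _) (hm _) (hm _) fun y z => ?_
        by_cases hy : (Fin.cons x y : Fin (n + 1) → ℝ) ∈ K
        swap
        · simp [hy, ha]
        by_cases hz : (Fin.cons (-x) z : Fin (n + 1) → ℝ) ∈ K
        swap
        · simp [hz, hb]
        have hyz := hK hy hz ha.le hb.le hab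
        have hcons : ((1 + r) / 2) • (Fin.cons x y : Fin (n + 1) → ℝ) +
            ((1 - r) / 2) • (Fin.cons (-x) z : Fin (n + 1) → ℝ) =
            Fin.cons (r * x) (((1 + r) / 2) • y + ((1 - r) / 2) • z) := by
          ext i
          refine Fin.cases ?_ (fun j => ?_) i
          · simp
            ring
          · simp
        rw [hcons] at hyz
        simpa [hy, hz, hyz] using gaussianWeight_logConcave ha hb hab y z

theorem lintegral_image_dilateFirst {n : ℕ} {K : Set (Fin (n + 1) → ℝ)} (hKm : MeasurableSet K)
    {t : ℝ} (ht : 0 < t) :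
    ∫⁻ x in dilateFirst (n + 1) t '' K, gaussianWeight x =
      ∫⁻ x : ℝ, ENNReal.ofReal (Real.exp (-x ^ 2 / 2)) * gaussianSlice K (t⁻¹ * x) := by
  have himg : MeasurableSet (dilateFirst (n + 1) t '' K) := by
    rw [image_dilateFirst _ ht.ne']
    exact (continuous_dilateFirst _ _).measurable hKm
  rw [← lintegral_indicator himg, lintegral_fin_succ (measurable_gaussianWeight.indicator himg)]
  refine lintegral_congr fun x => ?_
  rw [← lintegral_const_mul' _ _ ENNReal.ofReal_ne_top]
  refine lintegral_congr fun y => ?_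
  rw [image_dilateFirst _ ht.ne']
  have hw : gaussianWeight (Fin.cons x y : Fin (n + 1) → ℝ) =
      ENNReal.ofReal (Real.exp (-x ^ 2 / 2)) * gaussianWeight y := by
    unfold gaussianWeight
    rw [← ENNReal.ofReal_mul (by positivity), ← Real.exp_add, Fin.sum_univ_succ]
    simp only [Fin.cons_zero, Fin.cons_succ]
    congr 2
    ring
  classical
  simp only [Set.indicator_apply, Set.mem_preimage, dilateFirst_cons, hw, Pi.one_apply]
  split_ifs <;> simp

theorem lintegral_image_dilateFirst_mono {n : ℕ} {K : Set (Fin n → ℝ)} (hK : Convex ℝ K)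
    (hKsymm : K = -K) (hKm : MeasurableSet K) {s t : ℝ} (hs : 0 < s) (hst : s ≤ t) :
    ∫⁻ x in dilateFirst n s '' K, gaussianWeight x ≤
      ∫⁻ x in dilateFirst n t '' K, gaussianWeight x := by
  obtain rfl | hlt := hst.eq_or_lt
  · rfl
  cases n with
  | zero => simp [Subsingleton.elim (dilateFirst 0 s) (dilateFirst 0 t)]
  | succ n =>
    have ht : 0 < t := hs.trans hlt
    rw [lintegral_image_dilateFirst hKm hs, lintegral_image_dilateFirst hKm ht]
    refine lintegral_mono fun x => ?_
    have h := gaussianSlice_le_mul hK hKsymm hKm (div_pos hs ht) ((div_lt_one ht).2 hlt)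
      (s⁻¹ * x)
    rw [← mul_assoc, show s / t * s⁻¹ = t⁻¹ by field_simp] at h
    gcongr

end

/-- **Lemma 5.1.** For a symmetric convex set `K ⊆ ℝⁿ`, the function
`t ↦ γₙ(Δ(t,1,…,1)K)` is nondecreasing for `t > 0`, where `γₙ` is the standard Gaussian
measure and `Δ(t,1,…,1)` multiplies the first coordinate by `t`. -/
theorem gaussian_dilate_first_coordinate_monotone {n : ℕ}
    (γ : Measure (Fin n → ℝ))
    (hγ : γ = volume.withDensity
      (fun x => ENNReal.ofReal
        ((2 * Real.pi) ^ (-(n : ℝ) / 2) * Real.exp (-(∑ i, x i ^ 2) / 2))))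
    (K : Set (Fin n → ℝ)) (hK : Convex ℝ K) (hKsymm : K = -K) :
    ∀ s t : ℝ, 0 < s → s ≤ t →
      γ ((fun x i => if (i : ℕ) = 0 then s * x i else x i) '' K)
        ≤ γ ((fun x i => if (i : ℕ) = 0 then t * x i else x i) '' K) := by
  intro s t hs hst
  change γ (dilateFirst n s '' K) ≤ γ (dilateFirst n t '' K)
  have hγ_apply : ∀ A : Set (Fin n → ℝ), γ A =
      ENNReal.ofReal ((2 * Real.pi) ^ (-(n : ℝ) / 2)) * ∫⁻ x in A, gaussianWeight x := by
    intro A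
    rw [hγ, withDensity_apply', ← lintegral_const_mul _ measurable_gaussianWeight]
    refine lintegral_congr fun x => ?_
    rw [ENNReal.ofReal_mul (by positivity)]
  have hsymm : closure K = -closure K := by
    conv_lhs => rw [hKsymm]
    exact (Homeomorph.neg (Fin n → ℝ)).preimage_closure K |>.symm
  have hfront : γ (frontier (dilateFirst n t '' K)) = 0 := by
    rw [hγ]
    exact withDensity_absolutelyContinuous _ _
      ((hK.is_linear_image (isLinearMap_dilateFirst n t)).addHaar_frontier volume)
  calc γ (dilateFirst n s '' K) ≤ γ (dilateFirst n s '' closure K) :=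
        measure_mono (Set.image_mono subset_closure)
    _ ≤ γ (dilateFirst n t '' closure K) := by
        rw [hγ_apply, hγ_apply]
        exact mul_le_mul_right (lintegral_image_dilateFirst_mono hK.closure hsymm
          isClosed_closure.measurableSet hs hst) _
    _ ≤ γ (dilateFirst n t '' K ∪ frontier (dilateFirst n t '' K)) := measure_mono <| by
        rw [← closure_eq_self_union_frontier]
        exact image_closure_subset_closure_image (continuous_dilateFirst n t)
    _ ≤ γ (dilateFirst n t '' K) := (measure_union_le _ _).trans (by rw [hfront, add_zero])
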